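/- arXiv:1703.02705 — 7 statements merged into one kernel-verified Lean document; each statement's English description precedes it below -/
import Mathlib

section
/- Let p be a prime. Every nonzero residue class modulo p can be written as a finite product of central binomial coefficients C(2d, d) with 0 ≤ d ≤ (p-1)/2, reduced modulo p. Equivalently: the multiplicative closure S in (ℤ/pℤ)^× of the set { C(2d,d) mod p : 0 ≤ d ≤ (p-1)/2 } contains all nonzero residues modulo p. -/
theorem catalan_addendum_stmt0_aux (p : ℕ) (hp : p.Prime) (m : ℕ) (hm0 : 0 < m) (hm : m < p) :
    (m : ZMod p) ∈ Submonoid.closure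
      {x : ZMod p | ∃ d : ℕ, d ≤ (p - 1) / 2 ∧ x = (Nat.centralBinom d : ZMod p)} := by
  haveI := Fact.mk hp
  set S := Submonoid.closure
      {x : ZMod p | ∃ d : ℕ, d ≤ (p - 1) / 2 ∧ x = (Nat.centralBinom d : ZMod p)} with hS
  have hgen : ∀ d, d ≤ (p - 1) / 2 → (Nat.centralBinom d : ZMod p) ∈ S :=
    fun d hd => Submonoid.subset_closure ⟨d, hd, rfl⟩
  have hinv : ∀ x : ZMod p, x ≠ 0 → x ∈ S → x⁻¹ ∈ S := by
    intro x hx hxS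
    have h1 : x * x ^ (p - 2) = 1 := by
      rw [← pow_succ', show p - 2 + 1 = p - 1 by have := hp.two_le; omega]
      exact ZMod.pow_card_sub_one_eq_one hx
    rw [inv_eq_of_mul_eq_one_right h1]
    exact S.pow_mem hxS _
  induction m using Nat.strong_induction_on with
  | _ m ih =>
    by_cases h1 : m = 1
    · subst h1; simpa using S.one_mem
    have hp3 : 3 ≤ p := by omega
    have h2S : (2 : ZMod p) ∈ S := by
      have := hgen 1 (by omega)
      simpa [Nat.centralBinom] using this
    rcases Nat.even_or_odd' m with ⟨k, rfl | rfl⟩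
    · push_cast
      exact S.mul_mem h2S (ih k (by omega) (by omega) (by omega))
    · have hodd := hp.eq_two_or_odd
      have hk := ih (k + 1) (by omega) (by omega) (by omega)
      have hc1 := hgen (k + 1) (by omega)
      have hc0 := hgen k (by omega)
      have h2 : (2 : ZMod p) ≠ 0 := by
        intro h
        have : p ∣ 2 := (ZMod.natCast_eq_zero_iff 2 p).1 (by exact_mod_cast h)
        have := Nat.le_of_dvd (by norm_num) this
        omega
      have hc : (Nat.centralBinom k : ZMod p) ≠ 0 := by
        intro h
        have h' := (ZMod.natCast_eq_zero_iff _ p).1 h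
        have h3 : p ∣ (2 * k).factorial := by
          rw [← Nat.choose_mul_factorial_mul_factorial (show k ≤ 2 * k by omega)]
          rw [mul_assoc]
          exact Dvd.dvd.mul_right h' _
        have := (hp.dvd_factorial).1 h3
        omega
      have key : ((k + 1 : ℕ) : ZMod p) * (Nat.centralBinom (k + 1) : ZMod p)
          = 2 * ((2 * k + 1 : ℕ) : ZMod p) * (Nat.centralBinom k : ZMod p) := by
        exact_mod_cast congrArg (Nat.cast : ℕ → ZMod p) (Nat.succ_mul_centralBinom_succ k)
      have e : ((2 * k + 1 : ℕ) : ZMod p) = ((k + 1 : ℕ) : ZMod p) *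
          (Nat.centralBinom (k + 1) : ZMod p) * ((2 : ZMod p)⁻¹ *
            (Nat.centralBinom k : ZMod p)⁻¹) := by
        rw [key]; field_simp
      rw [e]
      exact S.mul_mem (S.mul_mem hk hc1) (S.mul_mem (hinv _ h2 h2S) (hinv _ hc hc0))

/-- Every nonzero residue class modulo a prime `p` lies in the multiplicative
closure (the submonoid generated) of the central binomial coefficients
`C(2d, d) mod p` for `0 ≤ d ≤ (p-1)/2`. -/
theorem catalan_addendum_stmt0 (p : ℕ) (hp : p.Prime) (a : ZMod p) (ha : a ≠ 0) :
    a ∈ Submonoid.closure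
      {x : ZMod p | ∃ d : ℕ, d ≤ (p - 1) / 2 ∧ x = (Nat.centralBinom d : ZMod p)} := by
  haveI := Fact.mk hp
  have h := catalan_addendum_stmt0_aux p hp a.val
    (Nat.pos_of_ne_zero (by simpa [ZMod.val_eq_zero] using ha)) (ZMod.val_lt a)
  rwa [ZMod.natCast_zmod_val] at h
end

section
/- Let p ≥ 5 be a prime. Then the Catalan numbers have no forbidden residue modulo p: for every residue class r modulo p (including 0) there exists a natural number n such that C_n ≡ r (mod p). -/
/-- Lucas for central binomials. -/
lemma centralBinom_lucas (p : ℕ) (hp : p.Prime) (M d : ℕ) (hd : 2 * d < p) :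
    (Nat.centralBinom (p * M + d) : ZMod p) = Nat.centralBinom M * Nat.centralBinom d := by
  haveI : Fact p.Prime := ⟨hp⟩
  have h := Choose.choose_modEq_choose_mod_mul_choose_div_nat (p := p)
    (n := 2 * (p * M + d)) (k := p * M + d)
  have e : 2 * (p * M + d) = 2 * d + p * (2 * M) := by ring
  have e' : p * M + d = d + p * M := by ring
  rw [e, e', Nat.add_mul_mod_self_left, Nat.add_mul_mod_self_left,
    Nat.add_mul_div_left _ _ hp.pos, Nat.add_mul_div_left _ _ hp.pos,
    Nat.mod_eq_of_lt hd, Nat.mod_eq_of_lt (by omega : d < p),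
    Nat.div_eq_of_lt hd, Nat.div_eq_of_lt (by omega : d < p), zero_add, zero_add] at h
  have h2 := (ZMod.natCast_eq_natCast_iff _ _ _).2 h
  rw [Nat.centralBinom, e, e', h2, Nat.cast_mul, mul_comm]
  rfl

lemma centralBinom_ne_zero_zmod (p : ℕ) (hp : p.Prime) (d : ℕ) (hd : 2 * d < p) :
    (Nat.centralBinom d : ZMod p) ≠ 0 := by
  intro h
  rw [ZMod.natCast_eq_zero_iff] at h
  have h1 := Nat.choose_mul_factorial_mul_factorial (show d ≤ 2 * d by omega)
  have h2 : p ∣ (2 * d).factorial := by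
    rw [← h1, mul_assoc]
    exact Dvd.dvd.mul_right h _
  exact absurd ((hp.dvd_factorial).1 h2) (by omega)

lemma mem_closure_all (p : ℕ) (hp : p.Prime) (hp5 : 5 ≤ p) (k : ℕ) (h0 : 0 < k) (hk : k < p) :
    (k : ZMod p) ∈ Submonoid.closure
      {x : ZMod p | ∃ d : ℕ, 2 * d < p ∧ (Nat.centralBinom d : ZMod p) = x} := by
  haveI : Fact p.Prime := ⟨hp⟩
  set G := Submonoid.closure
      {x : ZMod p | ∃ d : ℕ, 2 * d < p ∧ (Nat.centralBinom d : ZMod p) = x} with hG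
  have gen : ∀ d : ℕ, 2 * d < p → (Nat.centralBinom d : ZMod p) ∈ G := fun d hd =>
    Submonoid.subset_closure ⟨d, hd, rfl⟩
  have inv : ∀ x : ZMod p, x ≠ 0 → x ∈ G → x⁻¹ ∈ G := by
    intro x hx hxG
    have h1 : x * x ^ (p - 2) = 1 := by
      rw [← pow_succ', show p - 2 + 1 = p - 1 by omega]
      exact ZMod.pow_card_sub_one_eq_one hx
    rw [inv_eq_of_mul_eq_one_right h1]
    exact pow_mem hxG _
  have two : (2 : ZMod p) ∈ G := by
    have := gen 1 (by omega)
    simpa [Nat.centralBinom] using this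
  have two0 : (2 : ZMod p) ≠ 0 := by
    have := centralBinom_ne_zero_zmod p hp 1 (by omega)
    simpa [Nat.centralBinom] using this
  induction k using Nat.strong_induction_on with
  | _ k ih =>
  rcases Nat.even_or_odd' k with ⟨n, rfl | rfl⟩
  · rw [Nat.cast_mul]
    exact mul_mem (by exact_mod_cast two) (ih n (by omega) (by omega) (by omega))
  · rcases Nat.eq_zero_or_pos n with rfl | hn
    · simp
    · have hp2 : 2 * (n + 1) < p := by
        rcases hp.eq_two_or_odd with h | h <;> omega
      have hm := ih (n + 1) (by omega) (by omega) (by omega)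
      have hc := centralBinom_ne_zero_zmod p hp n (by omega)
      have key := congrArg (Nat.cast (R := ZMod p)) (Nat.succ_mul_centralBinom_succ n)
      rw [Nat.cast_mul, Nat.cast_mul, Nat.cast_mul, Nat.cast_ofNat] at key
      have e : ((2 * n + 1 : ℕ) : ZMod p) =
          ((n + 1 : ℕ) : ZMod p) * (Nat.centralBinom (n + 1) : ZMod p) *
            ((2 : ZMod p)⁻¹ * (Nat.centralBinom n : ZMod p)⁻¹) := by
        rw [key]
        field_simp
      rw [e]
      exact mul_mem (mul_mem hm (gen _ hp2)) (mul_mem (inv _ two0 two)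
        (inv _ hc (gen _ (by omega))))

/-- For any prime `p ≥ 5`, the Catalan numbers attain every residue class mod `p`. -/
theorem catalan_addendum_stmt1 (p : ℕ) (hp : p.Prime) (hp5 : 5 ≤ p) (r : ZMod p) :
    ∃ n : ℕ, (catalan n : ZMod p) = r := by
  haveI : Fact p.Prime := ⟨hp⟩
  suffices h : ∃ M : ℕ, (Nat.centralBinom M : ZMod p) = r by
    obtain ⟨M, rfl⟩ := h
    refine ⟨p * M, ?_⟩
    have h1 := congrArg (Nat.cast (R := ZMod p)) (succ_mul_catalan_eq_centralBinom (p * M))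
    have h2 := centralBinom_lucas p hp M 0 (by omega)
    simp at h1 h2
    rw [h1, h2]
  by_cases hr : r = 0
  · refine ⟨p - 1, ?_⟩
    rw [hr, ZMod.natCast_eq_zero_iff]
    have := Nat.succ_dvd_centralBinom (p - 1)
    rwa [Nat.sub_add_cancel hp.one_le] at this
  · have hm := mem_closure_all p hp hp5 r.val
      (Nat.pos_of_ne_zero (by rwa [Ne, ZMod.val_eq_zero])) (ZMod.val_lt r)
    rw [ZMod.natCast_zmod_val] at hm
    clear hr
    induction hm using Submonoid.closure_induction_left with
    | one => exact ⟨0, by simp⟩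
    | mul_left x hx y hy ih =>
      obtain ⟨d, hd, rfl⟩ := hx
      obtain ⟨M, rfl⟩ := ih
      exact ⟨p * M + d, by rw [centralBinom_lucas p hp M d hd, mul_comm]⟩
end

section
/- Let p be a prime and let n be a positive integer not divisible by p. Then n can be written as a product of central binomial coefficients modulo p: there exists a finite list of natural numbers d_1, …, d_k such that n ≡ ∏_{i=1}^k C(2d_i, d_i) (mod p). -/
/-- The submonoid of products of central binomial coefficients modulo `p`. -/
def centralProducts (p : ℕ) : Submonoid (ZMod p) where
  carrier := {x | ∃ L : List ℕ, x = (L.map (fun d => (Nat.centralBinom d : ZMod p))).prod}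
  one_mem' := ⟨[], by simp⟩
  mul_mem' := by
    rintro a b ⟨L, rfl⟩ ⟨M, rfl⟩
    exact ⟨L ++ M, by simp⟩

theorem centralBinom_mem_centralProducts (p d : ℕ) :
    (Nat.centralBinom d : ZMod p) ∈ centralProducts p := ⟨[d], by simp⟩

theorem inv_mem_centralProducts (p : ℕ) [Fact p.Prime] {x : ZMod p}
    (hx : x ∈ centralProducts p) (h0 : x ≠ 0) : x⁻¹ ∈ centralProducts p := by
  have h2 : 2 ≤ p := (Fact.out : p.Prime).two_le
  have h : x⁻¹ = x ^ (p - 2) := by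
    rw [inv_eq_iff_eq_inv, eq_comm, inv_eq_iff_eq_inv]
    apply eq_inv_of_mul_eq_one_left
    rw [← pow_succ, show p - 2 + 1 = p - 1 by omega]
    exact ZMod.pow_card_sub_one_eq_one h0
  rw [h]
  exact pow_mem hx _

theorem natCast_mem_centralProducts (p : ℕ) [Fact p.Prime] (m : ℕ) (hm : 0 < m) (hmp : m < p) :
    (m : ZMod p) ∈ centralProducts p := by
  have hp : p.Prime := Fact.out
  have two_mem : (2 : ZMod p) ∈ centralProducts p := by
    have := centralBinom_mem_centralProducts p 1
    simpa [Nat.centralBinom] using this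
  induction m using Nat.strong_induction_on with
  | _ m ih =>
    obtain ⟨k, rfl | rfl⟩ := m.even_or_odd'
    · push_cast
      exact mul_mem two_mem (ih k (by omega) (by omega) (by omega))
    · rcases Nat.eq_zero_or_pos k with rfl | hk
      · simpa using one_mem (centralProducts p)
      have h2 : (2 : ZMod p) ≠ 0 := by
        have : ((2 : ℕ) : ZMod p) ≠ 0 := by
          rw [Ne, ZMod.natCast_eq_zero_iff]
          exact fun h => absurd (Nat.le_of_dvd (by norm_num) h) (by omega)
        exact_mod_cast this
      have hc : (Nat.centralBinom k : ZMod p) ≠ 0 := by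
        rw [Ne, ZMod.natCast_eq_zero_iff]
        intro h
        have h' : p ∣ (2 * k).factorial := by
          refine h.trans ?_
          rw [Nat.centralBinom_eq_two_mul_choose,
            ← Nat.choose_mul_factorial_mul_factorial (show k ≤ 2 * k by omega), mul_assoc]
          exact dvd_mul_right _ _
        have := (hp.dvd_factorial).1 h'
        omega
      have key := congrArg (Nat.cast : ℕ → ZMod p) (Nat.succ_mul_centralBinom_succ k)
      push_cast at key
      have e : ((2 * k + 1 : ℕ) : ZMod p) =
          ((k + 1 : ℕ) : ZMod p) * (Nat.centralBinom (k + 1) : ZMod p) * 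
            ((2 : ZMod p)⁻¹ * (Nat.centralBinom k : ZMod p)⁻¹) := by
        push_cast
        rw [key]
        field_simp
      rw [e]
      exact mul_mem (mul_mem (ih (k + 1) (by omega) (by omega) (by omega))
        (centralBinom_mem_centralProducts p _))
        (mul_mem (inv_mem_centralProducts p two_mem h2)
          (inv_mem_centralProducts p (centralBinom_mem_centralProducts p k) hc))

/-- For any prime `p` and positive integer `n` not divisible by `p`, `n` is congruent
mod `p` to a product of central binomial coefficients. -/
theorem catalan_addendum_stmt2 (p n : ℕ) (hp : p.Prime) (hn : 0 < n) (hnp : ¬ p ∣ n) :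
    ∃ L : List ℕ, (n : ZMod p) = (L.map (fun d => (Nat.centralBinom d : ZMod p))).prod := by
  haveI : Fact p.Prime := ⟨hp⟩
  have h := natCast_mem_centralProducts p (n % p)
    (Nat.pos_of_ne_zero fun h => hnp (Nat.dvd_of_mod_eq_zero h)) (Nat.mod_lt _ hp.pos)
  rw [ZMod.natCast_mod] at h
  exact h
end

section
/- Let p ≥ 5 be a prime. Every residue class modulo p is attained infinitely often by the Catalan numbers: for every residue class r modulo p, the set { n ∈ ℕ : C_n ≡ r (mod p) } is infinite. -/
lemma cb_step (p : ℕ) [Fact p.Prime] (n k : ℕ) (hk : 2 * k < p) :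
    (Nat.centralBinom (p * n + k) : ZMod p) = Nat.centralBinom k * Nat.centralBinom n := by
  have hp : 0 < p := (Fact.out : p.Prime).pos
  have h := Choose.choose_modEq_choose_mod_mul_choose_div_nat
    (n := 2 * (p * n + k)) (k := p * n + k) (p := p)
  have e1 : 2 * (p * n + k) = 2 * k + p * (2 * n) := by ring
  have e2 : p * n + k = k + p * n := by ring
  rw [e1, e2, Nat.add_mul_mod_self_left, Nat.add_mul_mod_self_left,
    Nat.add_mul_div_left _ _ hp, Nat.add_mul_div_left _ _ hp, Nat.mod_eq_of_lt hk,
    Nat.mod_eq_of_lt (by omega), Nat.div_eq_of_lt hk, Nat.div_eq_of_lt (by omega),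
    zero_add, zero_add] at h
  have h' := (ZMod.natCast_eq_natCast_iff _ _ _).2 h
  rw [Nat.cast_mul] at h'
  simp only [Nat.centralBinom_eq_two_mul_choose]
  rw [e1, e2]
  exact h'

lemma cb_ne (p : ℕ) [Fact p.Prime] (k : ℕ) (hk : 2 * k < p) :
    (Nat.centralBinom k : ZMod p) ≠ 0 := by
  intro h
  rw [ZMod.natCast_eq_zero_iff] at h
  have h1 : Nat.centralBinom k ∣ (2 * k).factorial := by
    rw [Nat.centralBinom_eq_two_mul_choose,
      ← Nat.choose_mul_factorial_mul_factorial (show k ≤ 2 * k by omega), mul_assoc]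
    exact Dvd.intro _ rfl
  have := ((Fact.out : p.Prime).dvd_factorial).1 (h.trans h1)
  omega

/-- The multiplicative monoid generated by the central binomials of small digits. -/
def cbMon (p : ℕ) : Submonoid (ZMod p) :=
  Submonoid.closure {x | ∃ k : ℕ, 2 * k < p ∧ (Nat.centralBinom k : ZMod p) = x}

lemma cbMon_attained (p : ℕ) [Fact p.Prime] (x : ZMod p) (hx : x ∈ cbMon p) :
    ∃ n : ℕ, (Nat.centralBinom n : ZMod p) = x := by
  unfold cbMon at hx
  induction hx using Submonoid.closure_induction_left with
  | one => exact ⟨0, by simp⟩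
  | mul_left x hx y hy ih =>
    obtain ⟨k, hk, rfl⟩ := hx
    obtain ⟨n, rfl⟩ := ih
    exact ⟨p * n + k, cb_step p n k hk⟩

lemma cbMon_inv (p : ℕ) [Fact p.Prime] (x : ZMod p) (h0 : x ≠ 0) (hx : x ∈ cbMon p) :
    x⁻¹ ∈ cbMon p := by
  have h2 := (Fact.out : p.Prime).two_le
  have h : x⁻¹ = x ^ (p - 2) := by
    apply inv_eq_of_mul_eq_one_right
    rw [← pow_succ', show p - 2 + 1 = p - 1 by omega]
    exact ZMod.pow_card_sub_one_eq_one h0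
  rw [h]
  exact pow_mem hx _

lemma cbMon_nat (p : ℕ) [Fact p.Prime] (hp5 : 5 ≤ p) (m : ℕ) (h1 : 1 ≤ m) (hm : m < p) :
    (m : ZMod p) ∈ cbMon p := by
  have hB : ∀ k : ℕ, 2 * k < p → (Nat.centralBinom k : ZMod p) ∈ cbMon p :=
    fun k hk => Submonoid.subset_closure ⟨k, hk, rfl⟩
  have two_mem : (2 : ZMod p) ∈ cbMon p := by
    have := hB 1 (by omega)
    simpa [Nat.centralBinom] using this
  have hodd : p % 2 = 1 := (Fact.out : p.Prime).eq_two_or_odd.resolve_left (by omega)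
  have two_ne : (2 : ZMod p) ≠ 0 := by
    have := cb_ne p 1 (by omega)
    simpa [Nat.centralBinom] using this
  induction m using Nat.strong_induction_on with
  | _ m ih =>
    obtain ⟨k, hk | hk⟩ := Nat.even_or_odd' m
    · have := ih k (by omega) (by omega) (by omega)
      rw [hk, Nat.cast_mul]
      exact mul_mem (by simpa using two_mem) this
    · by_cases hk0 : k = 0
      · subst hk0
        rw [hk]
        simp
      · have hk1 := ih (k + 1) (by omega) (by omega) (by omega)
        have hr := congrArg (Nat.cast : ℕ → ZMod p) (Nat.succ_mul_centralBinom_succ k)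
        have hne := cb_ne p k (by omega)
        rw [Nat.cast_mul, Nat.cast_mul, Nat.cast_mul, ← hk] at hr
        have : (m : ZMod p) = ((k + 1 : ℕ) : ZMod p) * (Nat.centralBinom (k + 1) : ZMod p)
            * (2 : ZMod p)⁻¹ * (Nat.centralBinom k : ZMod p)⁻¹ := by
          rw [hr]
          push_cast
          field_simp
        rw [this]
        exact mul_mem (mul_mem (mul_mem hk1 (hB _ (by omega))) (cbMon_inv p _ two_ne two_mem))
          (cbMon_inv p _ hne (hB _ (by omega)))

lemma cb_attained (p : ℕ) [Fact p.Prime] (hp5 : 5 ≤ p) (r : ZMod p) :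
    ∃ n : ℕ, 1 ≤ n ∧ (Nat.centralBinom n : ZMod p) = r := by
  by_cases hr : r = 0
  · subst hr
    refine ⟨p - 1, by omega, ?_⟩
    rw [ZMod.natCast_eq_zero_iff, Nat.centralBinom_eq_two_mul_choose]
    exact (Fact.out : p.Prime).dvd_choose (by omega) (by omega) (by omega)
  · have two_ne : (2 : ZMod p) ≠ 0 := by
      have := cb_ne p 1 (by omega)
      simpa [Nat.centralBinom] using this
    have hs : r * 2⁻¹ ≠ 0 := mul_ne_zero hr (inv_ne_zero two_ne)
    have hv : 1 ≤ (r * 2⁻¹).val := by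
      rw [Nat.one_le_iff_ne_zero, Ne, ZMod.val_eq_zero]
      exact hs
    have hm := cbMon_nat p hp5 _ hv (ZMod.val_lt _)
    rw [ZMod.natCast_zmod_val] at hm
    obtain ⟨n, hn⟩ := cbMon_attained p _ hm
    refine ⟨p * n + 1, by omega, ?_⟩
    rw [cb_step p n 1 (by omega), hn]
    have : (Nat.centralBinom 1 : ZMod p) = 2 := by simp [Nat.centralBinom]
    rw [this]
    field_simp

/-- For any prime `p ≥ 5`, every residue class mod `p` is attained infinitely often
by the Catalan numbers. -/
theorem catalan_addendum_stmt3 (p : ℕ) (hp : p.Prime) (hp5 : 5 ≤ p) (r : ZMod p) :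
    {n : ℕ | (catalan n : ZMod p) = r}.Infinite := by
  haveI : Fact p.Prime := ⟨hp⟩
  obtain ⟨n, hn1, hn⟩ := cb_attained p hp5 r
  have hpow : ∀ j : ℕ, (Nat.centralBinom (p ^ j * n) : ZMod p) = r := by
    intro j
    induction j with
    | zero => simpa using hn
    | succ j ih =>
      have := cb_step p (p ^ j * n) 0 (by omega)
      rw [ih] at this
      rw [pow_succ', mul_assoc]
      simpa using this
  apply Set.infinite_of_injective_forall_mem (f := fun j : ℕ => p ^ (j + 1) * n)
  · intro a b hab
    have := Nat.eq_of_mul_eq_mul_right (by omega) hab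
    have := Nat.pow_right_injective (by omega : 2 ≤ p) this
    omega
  · intro j
    have h := congrArg (Nat.cast : ℕ → ZMod p) (succ_mul_catalan_eq_centralBinom (p ^ (j + 1) * n))
    rw [hpow] at h
    simpa [pow_succ] using h
end

section
/- Let p ≥ 5 be a prime. The set of natural numbers n for which C_n ≡ 0 (mod p) has asymptotic density 1; that is, the ratio #{ n < N : p divides C_n } / N tends to 1 as N → ∞. -/
open scoped Topology

/-- Number of `n < N` with `p` not dividing the central binomial coefficient. -/
def cbCount (p N : ℕ) : ℕ := ((Finset.range N).filter (fun n => ¬ p ∣ n.centralBinom)).card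

lemma cb_digit (p : ℕ) (hp : p.Prime) (n : ℕ) (h : ¬ p ∣ n.centralBinom) :
    2 * (n % p) < p ∧ ¬ p ∣ (n / p).centralBinom := by
  have := Fact.mk hp
  have L := Choose.choose_modEq_choose_mod_mul_choose_div_nat (n := 2 * n) (k := n) (p := p)
  have hr := Nat.mod_lt n hp.pos
  have hn := Nat.div_add_mod n p
  rw [Nat.centralBinom] at h
  rw [L.dvd_iff dvd_rfl] at h
  have h1 : 2 * (n % p) < p := by
    by_contra hc
    apply h
    have e : (2 * n) % p = 2 * (n % p) - p := by
      have : 2 * n = (2 * (n % p) - p) + p * (2 * (n / p) + 1) := by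
        have : p * (2 * (n / p) + 1) = 2 * (p * (n / p)) + p := by ring
        omega
      rw [this, Nat.add_mul_mod_self_left, Nat.mod_eq_of_lt (by omega)]
    rw [e, Nat.choose_eq_zero_of_lt (by omega)]
    simp
  refine ⟨h1, fun hd => h ?_⟩
  have e : (2 * n) / p = 2 * (n / p) := by
    have : 2 * n = 2 * (n % p) + p * (2 * (n / p)) := by
      have : p * (2 * (n / p)) = 2 * (p * (n / p)) := by ring
      omega
    conv_lhs => rw [this]
    rw [Nat.add_mul_div_left _ _ hp.pos, Nat.div_eq_of_lt h1, zero_add]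
  rw [e]
  exact Dvd.dvd.mul_left hd _

lemma cbCount_mul (p : ℕ) (hp : p.Prime) (N : ℕ) :
    cbCount p (p * N) ≤ ((p + 1) / 2) * cbCount p N := by
  unfold cbCount
  rw [mul_comm ((p+1)/2), ← Finset.card_range ((p + 1) / 2), ← Finset.card_product]
  refine Finset.card_le_card_of_injOn (fun n => (n / p, n % p)) ?_ ?_
  · intro n hn
    simp only [Finset.coe_filter, Finset.mem_range, Set.mem_ofPred_eq] at hn
    obtain ⟨h1, h2⟩ := cb_digit p hp n hn.2
    simp only [Finset.coe_product, Set.mem_prod, Finset.coe_filter, Finset.mem_range,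
      Set.mem_ofPred_eq, Finset.coe_range, Set.mem_Iio, Finset.card_range]
    exact ⟨⟨Nat.div_lt_of_lt_mul hn.1, h2⟩, by omega⟩
  · intro a _ b _ hab
    simp only [Prod.mk.injEq] at hab
    rw [← Nat.div_add_mod a p, ← Nat.div_add_mod b p, hab.1, hab.2]

lemma cbCount_pow (p : ℕ) (hp : p.Prime) (k N : ℕ) :
    cbCount p (p ^ k * N) ≤ ((p + 1) / 2) ^ k * N := by
  induction k with
  | zero =>
    simp only [pow_zero, one_mul, cbCount]
    exact (Finset.card_filter_le _ _).trans (by simp)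
  | succ k ih =>
    rw [pow_succ', mul_assoc, pow_succ', mul_assoc]
    exact (cbCount_mul p hp _).trans (Nat.mul_le_mul_left _ ih)

lemma cbCount_mono (p : ℕ) {a b : ℕ} (h : a ≤ b) : cbCount p a ≤ cbCount p b :=
  Finset.card_le_card (Finset.filter_subset_filter _ (Finset.range_subset_range.2 h))

lemma catalan_bad (p : ℕ) (hp : p.Prime) (hp5 : 5 ≤ p) (n : ℕ) (h : ¬ p ∣ catalan n) :
    ¬ p ∣ n.centralBinom ∨ ¬ p ∣ (n + 1).centralBinom := by
  by_contra! hc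
  obtain ⟨h1, h2⟩ := hc
  rw [← succ_mul_catalan_eq_centralBinom] at h1
  have h3 : p ∣ n + 1 := ((hp.dvd_mul).1 h1).resolve_right h
  have e : (n + 1).centralBinom = 2 * (2 * n + 1) * catalan n := by
    apply Nat.eq_of_mul_eq_mul_left (Nat.succ_pos n)
    have := Nat.succ_mul_centralBinom_succ n
    rw [← succ_mul_catalan_eq_centralBinom n] at this
    rw [Nat.succ_eq_add_one, this]
    ring
  rw [e] at h2
  rcases (hp.dvd_mul).1 ((((hp.dvd_mul).1 h2)).resolve_right h) with h4 | h4
  · have := Nat.le_of_dvd (by norm_num) h4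
    omega
  · have : p ∣ 2 * (n + 1) - (2 * n + 1) := Nat.dvd_sub (h3.mul_left 2) h4
    have h5 : 2 * (n + 1) - (2 * n + 1) = 1 := by omega
    rw [h5] at this
    have := Nat.le_of_dvd (by norm_num) this
    omega

lemma catalan_bad_card (p : ℕ) (hp : p.Prime) (hp5 : 5 ≤ p) (N : ℕ) :
    ((Finset.range N).filter (fun n => ¬ p ∣ catalan n)).card ≤ 2 * cbCount p (N + 1) := by
  have hsub : (Finset.range N).filter (fun n => ¬ p ∣ catalan n) ⊆
      (Finset.range N).filter (fun n => ¬ p ∣ n.centralBinom) ∪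
      (Finset.range N).filter (fun n => ¬ p ∣ (n + 1).centralBinom) := by
    intro n hn
    simp only [Finset.mem_filter, Finset.mem_union] at hn ⊢
    have := catalan_bad p hp hp5 n hn.2
    tauto
  have h1 : ((Finset.range N).filter (fun n => ¬ p ∣ n.centralBinom)).card ≤ cbCount p (N + 1) :=
    cbCount_mono p (Nat.le_succ N)
  have h2 : ((Finset.range N).filter (fun n => ¬ p ∣ (n + 1).centralBinom)).card
      ≤ cbCount p (N + 1) := by
    refine Finset.card_le_card_of_injOn (fun n => n + 1) ?_ ?_
    · intro n hn
      simp only [Finset.coe_filter, Finset.mem_range, Set.mem_ofPred_eq] at hn ⊢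
      exact ⟨by omega, hn.2⟩
    · intro a _ b _ hab
      simpa using hab
  have := (Finset.card_le_card hsub).trans (Finset.card_union_le _ _)
  omega

lemma catalan_bad_real (p : ℕ) (hp : p.Prime) (hp5 : 5 ≤ p) (k N : ℕ) :
    (((Finset.range N).filter (fun n => ¬ p ∣ catalan n)).card : ℝ) ≤
      2 * ((((p + 1) / 2 : ℕ) : ℝ) / p) ^ k * N + 2 * (((p + 1) / 2 : ℕ) : ℝ) ^ k := by
  have hpk : 0 < p ^ k := pow_pos hp.pos k
  have h1 : N + 1 ≤ p ^ k * (N / p ^ k + 1) := Nat.lt_mul_div_succ N hpk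
  have h2 := (catalan_bad_card p hp hp5 N).trans
    (Nat.mul_le_mul_left 2 ((cbCount_mono p h1).trans (cbCount_pow p hp k _)))
  have h3 : (((Finset.range N).filter (fun n => ¬ p ∣ catalan n)).card : ℝ) ≤
      2 * ((((p + 1) / 2 : ℕ) : ℝ) ^ k * (((N / p ^ k : ℕ) : ℝ) + 1)) := by exact_mod_cast h2
  have h4 : ((N / p ^ k : ℕ) : ℝ) ≤ (N : ℝ) / (p : ℝ) ^ k := by
    have := @Nat.cast_div_le ℝ _ _ _ N (p ^ k)
    simpa using this
  refine h3.trans ?_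
  calc _ ≤ 2 * ((((p + 1) / 2 : ℕ) : ℝ) ^ k * ((N : ℝ) / (p : ℝ) ^ k + 1)) := by gcongr
    _ = _ := by rw [div_pow]; ring

/-- For any prime `p ≥ 5`, the set of `n` with `p ∣ catalan n` has asymptotic density 1. -/
theorem catalan_addendum_stmt4 (p : ℕ) (hp : p.Prime) (hp5 : 5 ≤ p) :
    Filter.Tendsto
      (fun N : ℕ => ((Finset.range N).filter (fun n => p ∣ catalan n)).card / (N : ℝ))
      Filter.atTop (𝓝 1) := by
  rw [Metric.tendsto_atTop]
  intro ε hε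
  have hp0 : (0 : ℝ) < p := by exact_mod_cast hp.pos
  have hq1 : (((p + 1) / 2 : ℕ) : ℝ) / p < 1 := by
    rw [div_lt_one hp0]
    exact_mod_cast (by omega : (p + 1) / 2 < p)
  obtain ⟨k, hk⟩ := exists_pow_lt_of_lt_one (by positivity : 0 < ε / 4) hq1
  obtain ⟨M, hM⟩ := exists_nat_gt (2 * (((p + 1) / 2 : ℕ) : ℝ) ^ k / (ε / 2))
  refine ⟨M + 1, fun N hN => ?_⟩
  have hN0 : (0 : ℝ) < N := by exact_mod_cast (by omega : 0 < N)
  have hMN : (M : ℝ) ≤ N := by exact_mod_cast (by omega : M ≤ N)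
  have hb := catalan_bad_real p hp hp5 k N
  have hc : (((Finset.range N).filter (fun n => p ∣ catalan n)).card : ℝ) +
      ((Finset.range N).filter (fun n => ¬ p ∣ catalan n)).card = N := by
    have := Finset.card_filter_add_card_filter_not (s := Finset.range N) (fun n => p ∣ catalan n)
    rw [Finset.card_range] at this
    exact_mod_cast this
  rw [div_lt_iff₀ (by positivity)] at hM
  have h5 : (((Finset.range N).filter (fun n => ¬ p ∣ catalan n)).card : ℝ) < ε * N := by
    have h6 : ((((p + 1) / 2 : ℕ) : ℝ) / p) ^ k * N < ε / 4 * N := by gcongr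
    have h7 : (M : ℝ) * (ε / 2) ≤ N * (ε / 2) := by gcongr
    nlinarith
  have h0 : (0 : ℝ) ≤ ((Finset.range N).filter (fun n => ¬ p ∣ catalan n)).card := by positivity
  rw [Real.dist_eq, abs_lt]
  constructor
  · rw [lt_sub_iff_add_lt, lt_div_iff₀ hN0]
    nlinarith
  · rw [sub_lt_iff_lt_add, div_lt_iff₀ hN0]
    nlinarith [mul_pos hε hN0]
end

section
/- Let p ≥ 5 be a prime and let n be a natural number all of whose digits in base p lie in the set {0, 1, …, (p-1)/2}. Then the Catalan number C_n is not divisible by p. -/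
theorem centralBinom_not_dvd_aux (p : ℕ) (hp : p.Prime) (hp5 : 5 ≤ p) (n : ℕ) :
    (∀ a ∈ Nat.digits p n, a ≤ (p - 1) / 2) → ¬ p ∣ (2 * n).choose n := by
  induction n using Nat.strong_induction_on with
  | _ n ih =>
    intro hd
    haveI : Fact p.Prime := ⟨hp⟩
    rcases Nat.eq_zero_or_pos n with rfl | hn
    · simpa using hp.one_lt.ne'
    · rw [Nat.digits_def' hp.one_lt hn] at hd
      have h0 : n % p ≤ (p - 1) / 2 := hd _ (by simp)
      have h1 := ih (n / p) (Nat.div_lt_self hn hp.one_lt)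
        (fun a ha => hd a (List.mem_cons_of_mem _ ha))
      have hlt : 2 * (n % p) < p := by omega
      have e : 2 * n = 2 * (n % p) + p * (2 * (n / p)) := by
        have := Nat.mod_add_div n p
        calc 2 * n = 2 * (n % p + p * (n / p)) := by rw [this]
          _ = _ := by ring
      have hm : (2 * n) % p = 2 * (n % p) := by
        rw [e, Nat.add_mul_mod_self_left, Nat.mod_eq_of_lt hlt]
      have hq : (2 * n) / p = 2 * (n / p) := by
        rw [e, Nat.add_mul_div_left _ _ hp.pos, Nat.div_eq_of_lt hlt, zero_add]
      have hl := Choose.choose_modEq_choose_mod_mul_choose_div_nat (n := 2 * n) (k := n) (p := p)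
      rw [hm, hq] at hl
      rw [hl.dvd_iff dvd_rfl, hp.dvd_mul]
      rintro (h | h)
      · have h2 : p ∣ (2 * (n % p)).factorial := by
          rw [← Nat.choose_mul_factorial_mul_factorial (show n % p ≤ 2 * (n % p) by omega)]
          exact Dvd.dvd.mul_right (Dvd.dvd.mul_right h _) _
        exact absurd (hp.dvd_factorial.1 h2) (by omega)
      · exact h1 h

/-- For a prime `p ≥ 5`, if every base-`p` digit of `n` is at most `(p-1)/2`,
then `p` does not divide the Catalan number `C_n`. -/
theorem catalan_addendum_stmt5 (p n : ℕ) (hp : p.Prime) (hp5 : 5 ≤ p)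
    (hd : ∀ a ∈ Nat.digits p n, a ≤ (p - 1) / 2) :
    ¬ p ∣ catalan n := by
  intro h
  apply centralBinom_not_dvd_aux p hp hp5 n hd
  rw [← Nat.centralBinom_eq_two_mul_choose, ← succ_mul_catalan_eq_centralBinom]
  exact Dvd.dvd.mul_left h _
end

section
/- Let p ≥ 5 be a prime and let d_1, …, d_k be natural numbers, each satisfying d_i ≤ (p-1)/2. Then the product ∏_{i=1}^k C(2d_i, d_i) is attained modulo p as a residue of the Catalan numbers: there exists a natural number n such that C_n ≡ ∏_{i=1}^k C(2d_i, d_i) (mod p). -/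
theorem centralBinom_lucas_aux (p : ℕ) (hp : p.Prime) (m d : ℕ) (hd : 2 * d < p) :
    (Nat.centralBinom (p * m + d) : ZMod p) =
      (Nat.centralBinom d : ZMod p) * (Nat.centralBinom m : ZMod p) := by
  haveI := Fact.mk hp
  have h := Choose.choose_modEq_choose_mod_mul_choose_div_nat (p := p)
    (n := 2 * (p * m + d)) (k := p * m + d)
  have e : 2 * (p * m + d) = p * (2 * m) + 2 * d := by ring
  have hp0 := hp.pos
  have h1 : (p * (2 * m) + 2 * d) % p = 2 * d := by
    rw [Nat.mul_add_mod, Nat.mod_eq_of_lt hd]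
  have h2 : (p * (2 * m) + 2 * d) / p = 2 * m := by
    rw [Nat.mul_add_div hp0, Nat.div_eq_of_lt hd, add_zero]
  have hd' : d < p := by omega
  have h3 : (p * m + d) % p = d := by
    rw [Nat.mul_add_mod, Nat.mod_eq_of_lt hd']
  have h4 : (p * m + d) / p = m := by
    rw [Nat.mul_add_div hp0, Nat.div_eq_of_lt hd', add_zero]
  rw [e, h1, h2, h3, h4] at h
  have h' := (ZMod.natCast_eq_natCast_iff _ _ _).2 h
  rw [Nat.centralBinom, e, h', Nat.cast_mul]
  rfl

theorem centralBinom_prod_aux (p : ℕ) (hp : p.Prime)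
    (L : List ℕ) (hL : ∀ d ∈ L, 2 * d < p) :
    ∃ n : ℕ, (Nat.centralBinom n : ZMod p) =
      (L.map (fun d => (Nat.centralBinom d : ZMod p))).prod := by
  induction L with
  | nil => exact ⟨0, by simp⟩
  | cons d L ih =>
    obtain ⟨m, hm⟩ := ih (fun x hx => hL x (List.mem_cons_of_mem _ hx))
    refine ⟨p * m + d, ?_⟩
    rw [centralBinom_lucas_aux p hp m d (hL d List.mem_cons_self), hm]
    simp

/-- For a prime `p ≥ 5` and natural numbers `d₁, …, d_k` each at most `(p-1)/2`,
the product of the central binomial coefficients `C(2dᵢ, dᵢ)` is attained mod `p`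
as a residue of the Catalan numbers. -/
theorem catalan_addendum_stmt8 (p : ℕ) (hp : p.Prime) (hp5 : 5 ≤ p)
    (L : List ℕ) (hL : ∀ d ∈ L, d ≤ (p - 1) / 2) :
    ∃ n : ℕ, (catalan n : ZMod p) =
      (L.map (fun d => (Nat.centralBinom d : ZMod p))).prod := by
  obtain ⟨m, hm⟩ := centralBinom_prod_aux p hp L
    (fun d hd => by have := hL d hd; omega)
  refine ⟨p * m, ?_⟩
  rw [← hm]
  have h := centralBinom_lucas_aux p hp m 0 (by omega)
  have h2 := congrArg (Nat.cast : ℕ → ZMod p) (succ_mul_catalan_eq_centralBinom (p * m))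
  push_cast at h2
  simp only [CharP.cast_eq_zero, zero_mul, zero_add, one_mul] at h2
  rw [h2]
  simpa using h
end
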